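/- arXiv:2105.08414 — 3 statements merged into one kernel-verified Lean document; each statement's English description precedes it below -/
import Mathlib

section
/- (Lemma 1(i), Equivalent control laws.) For every POB affine control law given by (h_t, H_{t,τ}), there exist vectors g_t ∈ ℝ^{n_u}, matrices G_t ∈ ℝ^{n_u×n_x} and K_{t,τ} ∈ ℝ^{n_u×n_w} (0 ≤ τ ≤ t ≤ N−1), depending only on A, B, C, D, E, h, H, such that for every initial state x_0 and every disturbance sequence (w_t), the closed-loop inputs under the POB law satisfy u_t = g_t + G_t x_0 + ∑_{τ=0}^{t} K_{t,τ} w_τ for all 0 ≤ t ≤ N−1; consequently, the affine control law depending only on the initial state and disturbance sequence produces exactly the same closed-loop state and input trajectories as the POB law. -/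
open Matrix Finset

/-- Disturbance-to-error response matrices. -/
def pobF {nx nw : ℕ} (A : Matrix (Fin nx) (Fin nx) ℝ) (C : Matrix (Fin nx) (Fin nw) ℝ) :
    ℕ → ℕ → Matrix (Fin nx) (Fin nw) ℝ
  | 0, _ => 0
  | t + 1, s => A * pobF A C t s + if s = t then C else 0

theorem pob_ite {m n : ℕ} (M : Matrix (Fin m) (Fin n) ℝ) (w : ℕ → Fin n → ℝ) (t T : ℕ)
    (ht : t < T) :
    ∑ s ∈ Finset.range T, (if s = t then M else 0).mulVec (w s) = M.mulVec (w t) := by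
  rw [Finset.sum_eq_single t]
  · simp
  · intro b _ hb
    simp [hb]
  · intro hb
    exact absurd (Finset.mem_range.mpr ht) hb

theorem pob_err {nx nw : ℕ} (A : Matrix (Fin nx) (Fin nx) ℝ) (C : Matrix (Fin nx) (Fin nw) ℝ)
    (e : ℕ → Fin nx → ℝ) (w : ℕ → Fin nw → ℝ)
    (he : ∀ t, e (t + 1) = A.mulVec (e t) + C.mulVec (w t)) (T t : ℕ) (ht : t ≤ T) :
    e t = (A ^ t).mulVec (e 0) + ∑ s ∈ Finset.range T, (pobF A C t s).mulVec (w s) := by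
  induction t with
  | zero => simp [pobF]
  | succ t ih =>
    rw [he, ih (by omega)]
    simp only [pobF, Matrix.add_mulVec, Finset.sum_add_distrib, pob_ite C w t T (by omega),
      Matrix.mulVec_add, Matrix.mulVec_sum, Matrix.mulVec_mulVec, pow_succ']
    abel

/-- **Lemma 1(i), equivalent control laws.** For every purified-output-based
(POB) affine control law `u_t = h_t + ∑_{τ=0}^{t} H_{t,τ} v_τ` (where `v_τ = y_τ − ŷ_τ`
are the purified outputs), there exist vectors `g_t`, matrices `G_t` and `K_{t,τ}`,
depending only on `A, B, C, D, E, h, H`, such that for every initial state `x_0` and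
every disturbance sequence `w`, the closed-loop inputs under the POB law satisfy
`u_t = g_t + G_t x_0 + ∑_{τ=0}^{t} K_{t,τ} w_τ` for all `0 ≤ t ≤ N−1`; consequently, the
affine control law depending only on the initial state and disturbance sequence produces
exactly the same closed-loop state and input trajectories as the POB law. -/
theorem pob_law_equiv_initial_state_disturbance_law
    {nx nu nw ny : ℕ} (N : ℕ)
    (A : Matrix (Fin nx) (Fin nx) ℝ) (B : Matrix (Fin nx) (Fin nu) ℝ)
    (C : Matrix (Fin nx) (Fin nw) ℝ) (D : Matrix (Fin ny) (Fin nx) ℝ)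
    (E : Matrix (Fin ny) (Fin nw) ℝ)
    (h : ℕ → Fin nu → ℝ) (H : ℕ → ℕ → Matrix (Fin nu) (Fin ny) ℝ) :
    ∃ (g : ℕ → Fin nu → ℝ) (G : ℕ → Matrix (Fin nu) (Fin nx) ℝ)
      (K : ℕ → ℕ → Matrix (Fin nu) (Fin nw) ℝ),
      ∀ (x0 : Fin nx → ℝ) (w : ℕ → Fin nw → ℝ)
        (x xhat : ℕ → Fin nx → ℝ) (u : ℕ → Fin nu → ℝ),
        x 0 = x0 → xhat 0 = 0 →
        (∀ t, x (t + 1) = A.mulVec (x t) + B.mulVec (u t) + C.mulVec (w t)) →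
        (∀ t, xhat (t + 1) = A.mulVec (xhat t) + B.mulVec (u t)) →
        (∀ t, t < N →
          u t = h t + ∑ τ ∈ Finset.range (t + 1),
            (H t τ).mulVec
              ((D.mulVec (x τ) + E.mulVec (w τ)) - D.mulVec (xhat τ))) →
        ∀ t, t < N →
          u t = g t + (G t).mulVec x0
            + ∑ τ ∈ Finset.range (t + 1), (K t τ).mulVec (w τ) := by
  refine ⟨h, fun t => ∑ τ ∈ Finset.range (t + 1), H t τ * (D * A ^ τ),
    fun t s => ∑ τ ∈ Finset.range (t + 1),
      H t τ * (D * pobF A C τ s + if s = τ then E else 0), ?_⟩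
  intro x0 w x xhat u hx0 hxh hx hxhat hu t ht
  have he : ∀ t, (fun t => x t - xhat t) (t + 1)
      = A.mulVec ((fun t => x t - xhat t) t) + C.mulVec (w t) := by
    intro t
    simp only [hx, hxhat, Matrix.mulVec_sub]
    abel
  rw [hu t ht, add_assoc]
  congr 1
  simp only [Matrix.sum_mulVec]
  rw [Finset.sum_comm, ← Finset.sum_add_distrib]
  refine Finset.sum_congr rfl fun τ hτ => ?_
  have hτ' : τ < t + 1 := Finset.mem_range.mp hτ
  have h1 := pob_err A C (fun t => x t - xhat t) w he (t + 1) τ hτ'.le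
  simp only [hx0, hxh, sub_zero] at h1
  have h2 : D.mulVec (x τ) + E.mulVec (w τ) - D.mulVec (xhat τ)
      = D.mulVec (x τ - xhat τ) + E.mulVec (w τ) := by
    rw [Matrix.mulVec_sub]
    abel
  rw [h2, h1, ← pob_ite E w τ (t + 1) hτ']
  simp only [← Matrix.mulVec_mulVec, Matrix.add_mulVec, Matrix.mulVec_add, Matrix.mulVec_sum,
    Finset.sum_add_distrib]
  abel
end

section
/- (Lemma 1(ii), Equivalent output-feedback law.) For every POB affine control law given by (h_t, H_{t,τ}), there exist vectors g_t ∈ ℝ^{n_u} and matrices G_{t,τ} ∈ ℝ^{n_u×n_y} (0 ≤ τ ≤ t ≤ N−1), depending only on A, B, C, D, E, h, H, such that for every initial state x_0 and every disturbance sequence (w_t), the closed-loop inputs and outputs under the POB law satisfy u_t = g_t + ∑_{τ=0}^{t} G_{t,τ} y_τ for all 0 ≤ t ≤ N−1; that is, the POB law is realized by an affine control law depending only on the outputs of the disturbed system, which yields exactly the same closed-loop state and input trajectories. -/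
open Matrix Finset

/-- `s` is an affine function of the first `k` outputs. -/
def PobAff {ι : Type} {ny m : ℕ} (Y : ι → ℕ → Fin ny → ℝ) (k : ℕ) (s : ι → Fin m → ℝ) : Prop :=
  ∃ (c : Fin m → ℝ) (M : ℕ → Matrix (Fin m) (Fin ny) ℝ),
    ∀ i, s i = c + ∑ τ ∈ Finset.range k, (M τ).mulVec (Y i τ)

theorem PobAff.const {ι : Type} {ny m : ℕ} (Y : ι → ℕ → Fin ny → ℝ) (k : ℕ) (c : Fin m → ℝ) :
    PobAff Y k (fun _ => c) :=
  ⟨c, fun _ => 0, fun i => by simp⟩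

theorem PobAff.plus {ι : Type} {ny m : ℕ} {Y : ι → ℕ → Fin ny → ℝ} {k : ℕ}
    {s r : ι → Fin m → ℝ} (hs : PobAff Y k s) (hr : PobAff Y k r) :
    PobAff Y k (fun i => s i + r i) := by
  obtain ⟨c, M, h1⟩ := hs
  obtain ⟨d, L, h2⟩ := hr
  refine ⟨c + d, fun τ => M τ + L τ, fun i => ?_⟩
  simp only [h1, h2, Matrix.add_mulVec, Finset.sum_add_distrib]
  abel

theorem PobAff.mul {ι : Type} {ny m l : ℕ} {Y : ι → ℕ → Fin ny → ℝ} {k : ℕ}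
    {s : ι → Fin m → ℝ} (hs : PobAff Y k s) (K : Matrix (Fin l) (Fin m) ℝ) :
    PobAff Y k (fun i => K.mulVec (s i)) := by
  obtain ⟨c, M, h1⟩ := hs
  refine ⟨K.mulVec c, fun τ => K * M τ, fun i => ?_⟩
  simp only [h1, Matrix.mulVec_add, Matrix.mulVec_sum, Matrix.mulVec_mulVec]

theorem PobAff.mono {ι : Type} {ny m : ℕ} {Y : ι → ℕ → Fin ny → ℝ} {k k' : ℕ}
    {s : ι → Fin m → ℝ} (hs : PobAff Y k s) (hk : k ≤ k') : PobAff Y k' s := by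
  obtain ⟨c, M, h1⟩ := hs
  refine ⟨c, fun τ => if τ < k then M τ else 0, fun i => ?_⟩
  rw [h1, ← Finset.sum_subset (Finset.range_mono hk)]
  · congr 1
    refine Finset.sum_congr rfl fun τ hτ => ?_
    simp [Finset.mem_range.1 hτ]
  · intro τ _ hτ
    have h2 : ¬ τ < k := fun h3 => hτ (Finset.mem_range.2 h3)
    simp only [if_neg h2, Matrix.zero_mulVec]

theorem PobAff.out {ι : Type} {ny : ℕ} (Y : ι → ℕ → Fin ny → ℝ) {k t : ℕ} (ht : t < k) :
    PobAff Y k (fun i => Y i t) := by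
  refine ⟨0, fun τ => if τ = t then 1 else 0, fun i => ?_⟩
  rw [Finset.sum_eq_single t]
  · simp
  · intro b _ hb
    simp [hb]
  · intro hn
    exact absurd (Finset.mem_range.2 ht) hn

theorem PobAff.fsum {ι : Type} {ny m : ℕ} {Y : ι → ℕ → Fin ny → ℝ} {k : ℕ} (n : ℕ)
    {s : ℕ → ι → Fin m → ℝ} (hs : ∀ τ < n, PobAff Y k (s τ)) :
    PobAff Y k (fun i => ∑ τ ∈ Finset.range n, s τ i) := by
  induction n with
  | zero => simpa using PobAff.const Y k (0 : Fin m → ℝ)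
  | succ n ih =>
    simp only [Finset.sum_range_succ]
    exact (ih fun τ hτ => hs τ (by omega)).plus (hs n (by omega))

theorem pobAff_input {ι : Type} {nx nu ny : ℕ} (N : ℕ)
    (A : Matrix (Fin nx) (Fin nx) ℝ) (B : Matrix (Fin nx) (Fin nu) ℝ)
    (D : Matrix (Fin ny) (Fin nx) ℝ)
    (h : ℕ → Fin nu → ℝ) (H : ℕ → ℕ → Matrix (Fin nu) (Fin ny) ℝ)
    (X : ι → ℕ → Fin nx → ℝ) (Y : ι → ℕ → Fin ny → ℝ) (U : ι → ℕ → Fin nu → ℝ)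
    (h0 : ∀ i, X i 0 = 0)
    (hX : ∀ i t, X i (t + 1) = A.mulVec (X i t) + B.mulVec (U i t))
    (hU : ∀ i t, t < N → U i t = h t + ∑ τ ∈ Finset.range (t + 1),
            (H t τ).mulVec (Y i τ - D.mulVec (X i τ))) (t : ℕ) (ht : t < N) :
    PobAff Y (t + 1) (fun i => U i t) := by
  have key : ∀ t < N, (∀ τ ≤ t, PobAff Y τ (fun i => X i τ)) →
      PobAff Y (t + 1) (fun i => U i t) := by
    intro t ht hx
    simp only [fun i => hU i t ht]
    refine (PobAff.const Y _ (h t)).plus (PobAff.fsum (t + 1) fun τ hτ => ?_)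
    refine PobAff.mul ?_ _
    simp only [sub_eq_add_neg, ← Matrix.neg_mulVec]
    exact (PobAff.out Y hτ).plus (((hx τ (by omega)).mono (by omega)).mul _)
  have hx : ∀ t ≤ N, PobAff Y t (fun i => X i t) := by
    intro t
    induction t using Nat.strong_induction_on with
    | _ t ih =>
      intro ht
      cases t with
      | zero =>
        simp only [h0]
        exact PobAff.const Y _ _
      | succ t =>
        simp only [hX]
        exact (((ih t (by omega) (by omega)).mono (by omega)).mul A).plus
          ((key t (by omega) fun τ hτ => ih τ (by omega) (by omega)).mul B)
  exact key t ht fun τ hτ => hx τ (by omega)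

/-- **Lemma 1(ii), equivalent output-feedback law.** For every
purified-output-based (POB) affine control law `u_t = h_t + ∑_{τ=0}^{t} H_{t,τ} v_τ`
(where `v_τ = y_τ − ŷ_τ` are the purified outputs), there exist vectors `g_t` and
matrices `G_{t,τ}`, depending only on `A, B, C, D, E, h, H`, such that for every initial
state `x_0` and every disturbance sequence `w`, the closed-loop inputs and outputs under
the POB law satisfy `u_t = g_t + ∑_{τ=0}^{t} G_{t,τ} y_τ` for all `0 ≤ t ≤ N−1`; i.e. the
POB law is realized by an affine control law depending only on the outputs of the
disturbed system and yields exactly the same closed-loop state and input trajectories. -/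
theorem pob_law_equiv_output_feedback_law
    {nx nu nw ny : ℕ} (N : ℕ)
    (A : Matrix (Fin nx) (Fin nx) ℝ) (B : Matrix (Fin nx) (Fin nu) ℝ)
    (C : Matrix (Fin nx) (Fin nw) ℝ) (D : Matrix (Fin ny) (Fin nx) ℝ)
    (E : Matrix (Fin ny) (Fin nw) ℝ)
    (h : ℕ → Fin nu → ℝ) (H : ℕ → ℕ → Matrix (Fin nu) (Fin ny) ℝ) :
    ∃ (g : ℕ → Fin nu → ℝ) (G : ℕ → ℕ → Matrix (Fin nu) (Fin ny) ℝ),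
      ∀ (x0 : Fin nx → ℝ) (w : ℕ → Fin nw → ℝ)
        (x xhat : ℕ → Fin nx → ℝ) (y : ℕ → Fin ny → ℝ) (u : ℕ → Fin nu → ℝ),
        x 0 = x0 → xhat 0 = 0 →
        (∀ t, x (t + 1) = A.mulVec (x t) + B.mulVec (u t) + C.mulVec (w t)) →
        (∀ t, xhat (t + 1) = A.mulVec (xhat t) + B.mulVec (u t)) →
        (∀ t, y t = D.mulVec (x t) + E.mulVec (w t)) →
        (∀ t, t < N →
          u t = h t + ∑ τ ∈ Finset.range (t + 1),
            (H t τ).mulVec (y τ - D.mulVec (xhat τ))) →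
        ∀ t, t < N →
          u t = g t + ∑ τ ∈ Finset.range (t + 1), (G t τ).mulVec (y τ) := by
  let ι := {p : (ℕ → Fin nx → ℝ) × (ℕ → Fin ny → ℝ) × (ℕ → Fin nu → ℝ) //
    p.1 0 = 0 ∧ (∀ t, p.1 (t + 1) = A.mulVec (p.1 t) + B.mulVec (p.2.2 t)) ∧
    ∀ t, t < N → p.2.2 t = h t + ∑ τ ∈ Finset.range (t + 1),
      (H t τ).mulVec (p.2.1 τ - D.mulVec (p.1 τ))}
  have hA : ∀ t, ∃ (c : Fin nu → ℝ) (M : ℕ → Matrix (Fin nu) (Fin ny) ℝ), t < N →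
      ∀ i : ι, i.1.2.2 t = c + ∑ τ ∈ Finset.range (t + 1), (M τ).mulVec (i.1.2.1 τ) := by
    intro t
    by_cases ht : t < N
    · obtain ⟨c, M, hc⟩ := pobAff_input (ι := ι) N A B D h H (fun i => i.1.1) (fun i => i.1.2.1)
        (fun i => i.1.2.2) (fun i => i.2.1) (fun i => i.2.2.1) (fun i => i.2.2.2) t ht
      exact ⟨c, M, fun _ => hc⟩
    · exact ⟨0, 0, fun h => absurd h ht⟩
  choose g G hG using hA
  refine ⟨g, G, ?_⟩
  intro x0 w x xhat y u _ h0 _ hX _ hU t ht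
  exact hG t ht ⟨(xhat, y, u), h0, hX, hU⟩
end

section
/- (Worst-case expectation bound via couplings; sufficiency direction of Theorem 1.) Let Ξ ⊆ ℝ^n be measurable, let μ and Q be Borel probability measures on Ξ, and let π be a coupling of μ and Q, i.e. a Borel probability measure on Ξ × Ξ whose first marginal is μ and whose second marginal is Q, satisfying ∫ ‖ξ₁ − ξ₂‖ dπ(ξ₁,ξ₂) ≤ ε for some ε ≥ 0 and some norm ‖·‖ on ℝ^n. Let ℓ : Ξ → ℝ and s : Ξ → ℝ be measurable with s integrable with respect to μ and ℓ integrable with respect to Q, let λ ≥ 0, and suppose ℓ(ξ) ≤ s(ζ) + λ ‖ξ − ζ‖ for all ξ ∈ Ξ and μ-almost every ζ ∈ Ξ. Then ∫ ℓ dQ ≤ ∫ s dμ + λ ε. In particular, when μ = (1/N) ∑_{i=1}^N δ_{ξ̂_i} is the empirical distribution on sample points ξ̂_1,…,ξ̂_N ∈ Ξ and s(ξ̂_i) = s_i, every distribution Q within type-1 Wasserstein distance ε of μ satisfies ∫ ℓ dQ ≤ λ ε + (1/N) ∑_{i=1}^N s_i. -/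
open MeasureTheory

/-- **worst-case expectation bound via couplings; sufficiency direction of
Theorem 1.** Let `Ξ ⊆ ℝ^n` be measurable, `μ` and `Q` Borel probability measures
supported on `Ξ`, and `π` a coupling of `μ` and `Q` (first marginal `μ`, second marginal
`Q`) with transport cost `∫ ‖ξ₁ − ξ₂‖ dπ ≤ ε` for a norm `‖·‖` on `ℝ^n` and `ε ≥ 0`.
Let `ℓ, s` be measurable with `s` `μ`-integrable and `ℓ` `Q`-integrable, `λ ≥ 0`, and
suppose `ℓ(ξ) ≤ s(ζ) + λ ‖ξ − ζ‖` for all `ξ ∈ Ξ` and `μ`-a.e. `ζ ∈ Ξ`. Then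
`∫ ℓ dQ ≤ ∫ s dμ + λ ε`. (In particular, with `μ` the empirical distribution on sample
points `ξ̂_1,…,ξ̂_N` and `s(ξ̂_i) = s_i`, every distribution within type-1 Wasserstein
distance `ε` of `μ` satisfies `∫ ℓ dQ ≤ λ ε + (1/N) ∑ s_i`.) -/
theorem worst_case_expectation_bound_coupling
    {n : ℕ} (Ξ : Set (Fin n → ℝ)) (hΞ : MeasurableSet Ξ)
    (nrm : (Fin n → ℝ) → ℝ)
    (h_add : ∀ x y : Fin n → ℝ, nrm (x + y) ≤ nrm x + nrm y)
    (h_smul : ∀ (r : ℝ) (x : Fin n → ℝ), nrm (r • x) = |r| * nrm x)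
    (h_eq_zero : ∀ x : Fin n → ℝ, nrm x = 0 ↔ x = 0)
    (μ Q : Measure (Fin n → ℝ)) [IsProbabilityMeasure μ] [IsProbabilityMeasure Q]
    (hμΞ : μ Ξ = 1) (hQΞ : Q Ξ = 1)
    (π : Measure ((Fin n → ℝ) × (Fin n → ℝ))) [IsProbabilityMeasure π]
    (hπ1 : π.map Prod.fst = μ) (hπ2 : π.map Prod.snd = Q)
    (ε : ℝ) (hε : 0 ≤ ε)
    (hcost_int : Integrable (fun p => nrm (p.1 - p.2)) π)
    (hcost : ∫ p, nrm (p.1 - p.2) ∂π ≤ ε)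
    (ℓ s : (Fin n → ℝ) → ℝ) (hℓmeas : Measurable ℓ) (hsmeas : Measurable s)
    (hs_int : Integrable s μ) (hℓ_int : Integrable ℓ Q)
    (lam : ℝ) (hlam : 0 ≤ lam)
    (hpt : ∀ᵐ ζ ∂μ, ζ ∈ Ξ ∧ ∀ ξ ∈ Ξ, ℓ ξ ≤ s ζ + lam * nrm (ξ - ζ)) :
    ∫ ξ, ℓ ξ ∂Q ≤ (∫ ζ, s ζ ∂μ) + lam * ε := by
  have hsym : ∀ x y : Fin n → ℝ, nrm (x - y) = nrm (y - x) := by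
    intro x y
    have h := h_smul (-1) (y - x)
    simpa using h
  have hQ : ∀ᵐ ξ ∂Q, ξ ∈ Ξ := by
    rw [← prob_compl_eq_zero_iff hΞ] at hQΞ
    exact hQΞ
  subst hπ1 hπ2
  have h1 := ae_of_ae_map measurable_fst.aemeasurable hpt
  have h2 := ae_of_ae_map measurable_snd.aemeasurable hQ
  have hs' : Integrable (fun p : (Fin n → ℝ) × (Fin n → ℝ) => s p.1) π :=
    hs_int.comp_measurable measurable_fst
  have hl' : Integrable (fun p : (Fin n → ℝ) × (Fin n → ℝ) => ℓ p.2) π :=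
    hℓ_int.comp_measurable measurable_snd
  rw [integral_map measurable_fst.aemeasurable hsmeas.aestronglyMeasurable,
    integral_map measurable_snd.aemeasurable hℓmeas.aestronglyMeasurable]
  calc ∫ p, ℓ p.2 ∂π ≤ ∫ p, (s p.1 + lam * nrm (p.1 - p.2)) ∂π := by
        refine integral_mono_ae hl' (hs'.add (hcost_int.const_mul lam)) ?_
        filter_upwards [h1, h2] with p hp hp2
        rw [hsym]
        exact hp.2 _ hp2
    _ = ∫ p, s p.1 ∂π + lam * ∫ p, nrm (p.1 - p.2) ∂π := by
        rw [integral_add hs' (hcost_int.const_mul lam), integral_const_mul]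
    _ ≤ _ := by gcongr
end
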